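/- arXiv:2509.02616 — 6 statements merged into one kernel-verified Lean document; each statement's English description precedes it below -/
import Mathlib

section
/- Let V be a finite set with n elements, let < be a strict partial order on V, and let G be a simple graph on V such that any two adjacent vertices of G are comparable under <. Let k be a positive integer with n > 10k, and suppose that every subset of V of size k contains at least one edge of G. Then there exists a vertex u ∈ V such that the number of elements x with x < u is at least n/(3k) and the number of elements x with u < x is at least n/(3k). -/
/-- If antichains have at most `w` elements and every element of `S` has fewer than `m`
predecessors in `S`, then `S` has at most `m * w` elements. -/
theorem Finset.card_le_mul_of_card_pred_lt {V : Type*} [Finite V] {r : V → V → Prop}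
    (hirr : ∀ x, ¬ r x x) (htrans : ∀ x y z, r x y → r y z → r x z) {w : ℕ}
    (hw : ∀ T : Finset V, (∀ x ∈ T, ∀ y ∈ T, ¬ r x y) → T.card ≤ w) (m : ℕ) (S : Finset V)
    (hS : ∀ x ∈ S, {y | y ∈ S ∧ r y x}.ncard < m) : S.card ≤ m * w := by
  classical
  induction m generalizing S with
  | zero =>
    have h : S = ∅ := Finset.eq_empty_of_forall_notMem fun x hx => by simpa using hS x hx
    simp [h]
  | succ m ih =>
    have hwf : WellFounded r :=
      haveI : Std.Irrefl r := ⟨hirr⟩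
      haveI : IsTrans V r := ⟨htrans⟩
      Finite.wellFounded_of_trans_of_irrefl r
    let M := S.filter fun x => ∀ y ∈ S, ¬ r y x
    have hM : M.card ≤ w := hw M fun x hx y hy =>
      (Finset.mem_filter.1 hy).2 x (Finset.mem_filter.1 hx).1
    have hSM : (S \ M).card ≤ m * w := by
      refine ih _ fun x hx => ?_
      obtain ⟨hxS, hxM⟩ := Finset.mem_sdiff.1 hx
      have hne : {y | y ∈ S ∧ r y x}.Nonempty := by
        by_contra h
        exact hxM (Finset.mem_filter.2 ⟨hxS, fun y hy hyx => h ⟨y, hy, hyx⟩⟩)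
      obtain ⟨y, ⟨hyS, hyx⟩, hmin⟩ := hwf.has_min _ hne
      have hyM : y ∈ M :=
        Finset.mem_filter.2 ⟨hyS, fun z hz hzy => hmin z ⟨hz, htrans _ _ _ hzy hyx⟩ hzy⟩
      have hlt : {z | z ∈ S \ M ∧ r z x}.ncard < {z | z ∈ S ∧ r z x}.ncard := by
        refine Set.ncard_lt_ncard ⟨fun z hz => ⟨(Finset.mem_sdiff.1 hz.1).1, hz.2⟩, fun h => ?_⟩
          (Set.toFinite _)
        exact (Finset.mem_sdiff.1 (h ⟨hyS, hyx⟩).1).2 hyM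
      have := hS x hxS
      omega
    have : (S \ M).card + M.card = S.card :=
      Finset.card_sdiff_add_card_eq_card (Finset.filter_subset _ S)
    rw [Nat.succ_mul]
    omega


/-- Lemma 4.1 (graph form): existence of a good pivot in a partially probed
comparison graph whose forbidden graph has no independent set of size `k`. -/
theorem stmt_0 {V : Type*} [Fintype V]
    (n : ℕ) (hn : n = Fintype.card V)
    (r : V → V → Prop)
    (hirr : ∀ x, ¬ r x x)
    (htrans : ∀ x y z, r x y → r y z → r x z)
    (G : SimpleGraph V)
    (hcomp : ∀ u v, G.Adj u v → r u v ∨ r v u)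
    (k : ℕ) (hk : 0 < k) (hnk : n > 10 * k)
    (hedge : ∀ s : Finset V, s.card = k → ∃ u ∈ s, ∃ v ∈ s, G.Adj u v) :
    ∃ u : V,
      (n : ℝ) / (3 * k) ≤ ({x : V | r x u} : Set V).ncard ∧
      (n : ℝ) / (3 * k) ≤ ({x : V | r u x} : Set V).ncard := by
  classical
  obtain ⟨w, rfl⟩ : ∃ w, k = w + 1 := ⟨k - 1, by omega⟩
  have hw : ∀ T : Finset V, (∀ x ∈ T, ∀ y ∈ T, ¬ r x y) → T.card ≤ w := by
    intro T hT
    by_contra! h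
    obtain ⟨s, hsT, hs⟩ := Finset.exists_subset_card_eq (Nat.succ_le_of_lt h)
    obtain ⟨u, hu, v, hv, huv⟩ := hedge s hs
    rcases hcomp u v huv with h | h
    · exact hT u (hsT hu) v (hsT hv) h
    · exact hT v (hsT hv) u (hsT hu) h
  let m := ⌈(n : ℝ) / (3 * (w + 1 : ℕ))⌉₊
  have hbound : 2 * (m * w) < n := by
    have h1 : (m : ℝ) < n / (3 * (w + 1 : ℕ)) + 1 := Nat.ceil_lt_add_one (by positivity)
    have h2 : (m : ℝ) * (w + 1) < n / 3 + (w + 1) := by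
      calc (m : ℝ) * (w + 1) < (n / (3 * (w + 1 : ℕ)) + 1) * (w + 1) := by gcongr
        _ = n / 3 + (w + 1) := by push_cast; field_simp
    have h3 : (10 : ℝ) * (w + 1) < n := by exact_mod_cast hnk
    have h4 : (0 : ℝ) ≤ m := by positivity
    have h5 : (2 : ℝ) * (m * w) < n := by linarith
    exact_mod_cast h5
  let A := Finset.univ.filter fun u => {x | r x u}.ncard < m
  let B := Finset.univ.filter fun u => {x | r u x}.ncard < m
  have hA : A.card ≤ m * w :=
    Finset.card_le_mul_of_card_pred_lt hirr htrans hw m A fun x hx =>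
      (Set.ncard_le_ncard (fun y hy => hy.2) (Set.toFinite _)).trans_lt (Finset.mem_filter.1 hx).2
  have hB : B.card ≤ m * w :=
    Finset.card_le_mul_of_card_pred_lt (r := fun x y => r y x) hirr
      (fun x y z hxy hyz => htrans z y x hyz hxy)
      (fun T hT => hw T fun x hx y hy => hT y hy x hx) m B fun x hx =>
      (Set.ncard_le_ncard (fun y hy => hy.2) (Set.toFinite _)).trans_lt (Finset.mem_filter.1 hx).2
  obtain ⟨u, -, hu⟩ : ∃ u ∈ Finset.univ, u ∉ A ∪ B := by
    refine Finset.exists_mem_notMem_of_card_lt_card ?_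
    have := Finset.card_union_le A B
    rw [Finset.card_univ]
    omega
  simp only [A, B, Finset.mem_union, Finset.mem_filter, Finset.mem_univ, true_and, not_or,
    not_lt] at hu
  exact ⟨u, Nat.ceil_le.1 hu.1, Nat.ceil_le.1 hu.2⟩
end

section
/- Let (V, <) be a finite strict partially ordered set with n elements, and let k be a positive integer with n > 10k. Suppose that among every k elements of V, some two are comparable (equivalently, every antichain of V has fewer than k elements). Then there exists an element u ∈ V such that the number of elements x with x < u is at least n/(3k) and the number of elements x with u < x is at least n/(3k). -/
open Finset in
/-- If every `k`-element set contains two `r`-related elements and `g` takes distinct values on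
`r`-related elements, then at most `m * k` elements have `g`-value below `m`. -/
theorem card_filter_lt_le_mul {V : Type*} [Fintype V] {r : V → V → Prop} {k : ℕ}
    (hcomp : ∀ s : Finset V, s.card = k → ∃ u ∈ s, ∃ v ∈ s, u ≠ v ∧ (r u v ∨ r v u))
    {g : V → ℕ} (hg : ∀ x y, r x y → g x ≠ g y) (m : ℕ) :
    (univ.filter fun x => g x < m).card ≤ m * k := by
  classical
  have h := card_le_mul_card_image_of_maps_to (s := univ.filter fun x => g x < m)
    (t := range m) (f := g) (by simp) k fun b _ => by
      by_contra! hlt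
      obtain ⟨s, hs, hsk⟩ := exists_subset_card_eq hlt.le
      obtain ⟨u, hu, v, hv, -, huv⟩ := hcomp s hsk
      have hub := (mem_filter.1 (hs hu)).2
      have hvb := (mem_filter.1 (hs hv)).2
      rcases huv with huv | huv
      · exact hg _ _ huv (hub.trans hvb.symm)
      · exact hg _ _ huv (hvb.trans hub.symm)
  simpa [mul_comm] using h

/-- In a finite strict order, the number of predecessors is strictly monotone. -/
theorem ncard_setOf_rel_lt {V : Type*} [Finite V] {r : V → V → Prop}
    (hirr : ∀ x, ¬ r x x) (htrans : ∀ x y z, r x y → r y z → r x z) {x y : V} (h : r x y) :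
    ({z | r z x} : Set V).ncard < ({z | r z y} : Set V).ncard :=
  Set.ncard_lt_ncard ⟨fun z hz => htrans z x y hz h, fun hs => hirr x (hs h)⟩ (Set.toFinite _)


/-- Lemma 4.1 (order-theoretic form): in a finite strict poset with `n > 10k`
elements in which among any `k` elements some two are comparable, there is a
pivot `u` with at least `n/(3k)` elements below it and at least `n/(3k)`
elements above it. -/
theorem stmt_1 {V : Type*} [Fintype V]
    (n : ℕ) (hn : n = Fintype.card V)
    (r : V → V → Prop)
    (hirr : ∀ x, ¬ r x x)
    (htrans : ∀ x y z, r x y → r y z → r x z)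
    (k : ℕ) (hk : 0 < k) (hnk : n > 10 * k)
    (hcomp : ∀ s : Finset V, s.card = k →
      ∃ u ∈ s, ∃ v ∈ s, u ≠ v ∧ (r u v ∨ r v u)) :
    ∃ u : V,
      (n : ℝ) / (3 * k) ≤ ({x : V | r x u} : Set V).ncard ∧
      (n : ℝ) / (3 * k) ≤ ({x : V | r u x} : Set V).ncard := by
  classical
  set m := ⌈(n : ℝ) / (3 * k)⌉₊ with hm
  have below := card_filter_lt_le_mul hcomp
    (g := fun x => ({z | r z x} : Set V).ncard)
    (fun x y h => (ncard_setOf_rel_lt hirr htrans h).ne) m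
  have above := card_filter_lt_le_mul hcomp
    (g := fun x => ({z | r x z} : Set V).ncard)
    (fun x y h => (ncard_setOf_rel_lt (r := fun a b => r b a) hirr
      (fun a b c hab hbc => htrans c b a hbc hab) h).ne') m
  by_contra! hno
  have hcover : (Finset.univ : Finset V) ⊆
      (Finset.univ.filter fun x => ({z | r z x} : Set V).ncard < m) ∪
      (Finset.univ.filter fun x => ({z | r x z} : Set V).ncard < m) := by
    intro x _
    simp only [Finset.mem_union, Finset.mem_filter, Finset.mem_univ, true_and, hm, Nat.lt_ceil]
    exact or_iff_not_imp_left.2 fun h => hno x (not_lt.1 h)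
  have hle : n ≤ 2 * (m * k) := by
    have h := (Finset.card_le_card hcover).trans (Finset.card_union_le _ _)
    rw [Finset.card_univ, ← hn] at h
    omega
  have hk' : (0 : ℝ) < k := by exact_mod_cast hk
  have hmk : (m : ℝ) * (3 * k) < n + 3 * k := by
    have h := Nat.ceil_lt_add_one (show (0 : ℝ) ≤ (n : ℝ) / (3 * k) by positivity)
    rw [← hm, div_add_one (by positivity), lt_div_iff₀ (by positivity)] at h
    exact h
  have hle' : (n : ℝ) ≤ 2 * (m * k) := by exact_mod_cast hle
  have hnk' : (10 : ℝ) * k < n := by exact_mod_cast hnk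
  linarith
end

section
/- Let (V, <) be a finite strict partially ordered set with n elements, and let k be a positive integer with n > 10k. Suppose that among every k elements of V, some two are comparable (equivalently, every antichain of V has fewer than k elements). Then more than n/2 elements u of V satisfy: the number of elements x with u < x is at least n/(3k). -/
/-- In a partial order whose finite antichains have at most `k` elements, every finite set with
more than `j * k` elements has an element lying below at least `j` others of that set. -/
theorem exists_le_card_filter_lt {α : Type*} [PartialOrder α] [DecidableEq α]
    [DecidableLT α] {k : ℕ}
    (hk : ∀ s : Finset α, IsAntichain (· ≤ ·) (s : Set α) → s.card ≤ k)
    (j : ℕ) (S : Finset α) (hS : j * k < S.card) :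
    ∃ u ∈ S, j ≤ (S.filter (u < ·)).card := by
  classical
  induction j generalizing S with
  | zero =>
    obtain ⟨u, hu⟩ := Finset.card_pos.mp (by omega : 0 < S.card)
    exact ⟨u, hu, Nat.zero_le _⟩
  | succ j ih =>
    let M := S.filter fun x => Maximal (· ∈ S) x
    have hM : M.card ≤ k := by
      refine hk M fun a ha b hb hab hle => hab ?_
      simp only [M, Finset.coe_filter, Set.mem_ofPred_eq] at ha hb
      exact ha.2.eq_of_le hb.1 hle
    have hcard : j * k < (S \ M).card := by
      have := Finset.le_card_sdiff M S
      rw [Nat.succ_mul] at hS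
      omega
    obtain ⟨u, hu, hju⟩ := ih (S \ M) hcard
    obtain ⟨huS, huM⟩ := Finset.mem_sdiff.mp hu
    obtain ⟨m, hum, hm⟩ := S.exists_le_maximal huS
    have hmM : m ∈ M := Finset.mem_filter.mpr ⟨hm.prop, hm⟩
    have hlt : u < m := lt_of_le_of_ne hum fun h => huM (h ▸ hmM)
    refine ⟨u, huS, hju.trans_lt (Finset.card_lt_card ?_)⟩
    refine Finset.ssubset_iff_of_subset
      (Finset.filter_subset_filter _ Finset.sdiff_subset) |>.mpr ⟨m, ?_, ?_⟩
    · exact Finset.mem_filter.mpr ⟨hm.prop, hlt⟩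
    · simp [hmM]

/-- Lemma 4.2 (upward direction): in a finite strict poset with `n > 10k`
elements in which among any `k` elements some two are comparable, more than
`n/2` elements have at least `n/(3k)` elements above them. -/
theorem stmt_2 {V : Type*} [Fintype V]
    (n : ℕ) (hn : n = Fintype.card V)
    (r : V → V → Prop)
    (hirr : ∀ x, ¬ r x x)
    (htrans : ∀ x y z, r x y → r y z → r x z)
    (k : ℕ) (hk : 0 < k) (hnk : n > 10 * k)
    (hcomp : ∀ s : Finset V, s.card = k →
      ∃ u ∈ s, ∃ v ∈ s, u ≠ v ∧ (r u v ∨ r v u)) :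
    (n : ℝ) / 2 <
      ({u : V | (n : ℝ) / (3 * k) ≤ ({x : V | r u x} : Set V).ncard} : Set V).ncard := by
  classical
  have : IsStrictOrder V r := { irrefl := hirr, trans := htrans }
  let _ : PartialOrder V := partialOrderOfSO r
  have hanti (s : Finset V) (hs : IsAntichain (· ≤ ·) (s : Set V)) : s.card ≤ k := by
    by_contra! hlt
    obtain ⟨t, hts, htk⟩ := Finset.exists_subset_card_eq hlt.le
    obtain ⟨u, hu, v, hv, huv, h | h⟩ := hcomp t htk
    · exact hs (hts hu) (hts hv) huv (le_of_lt (show u < v from h))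
    · exact hs (hts hv) (hts hu) huv.symm (le_of_lt (show v < u from h))
  by_contra! hle
  let good : Finset V :=
    Finset.univ.filter fun u => (n : ℝ) / (3 * k) ≤ ({x : V | r u x} : Set V).ncard
  have hgood : (good.card : ℝ) ≤ n / 2 := by
    rw [← Set.ncard_coe_finset]
    simpa [good] using hle
  have hcompl : (good.card : ℝ) + goodᶜ.card = n := by
    rw [hn]
    exact_mod_cast good.card_add_card_compl
  have hk0 : (0 : ℝ) < k := by exact_mod_cast hk
  have hnk' : (10 : ℝ) * k < n := by exact_mod_cast hnk
  have hceil : (⌈(n : ℝ) / (3 * k)⌉₊ : ℝ) < n / (3 * k) + 1 :=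
    Nat.ceil_lt_add_one (by positivity)
  have hsize : ⌈(n : ℝ) / (3 * k)⌉₊ * k < goodᶜ.card := by
    have hmul := mul_lt_mul_of_pos_right hceil hk0
    have heq : ((n : ℝ) / (3 * k) + 1) * k = n / 3 + k := by field_simp
    have : (⌈(n : ℝ) / (3 * k)⌉₊ : ℝ) * k < goodᶜ.card := by linarith
    exact_mod_cast this
  obtain ⟨u, hu, hju⟩ := exists_le_card_filter_lt hanti _ _ hsize
  refine Finset.mem_compl.mp hu (Finset.mem_filter.mpr ⟨Finset.mem_univ u, ?_⟩)
  refine (Nat.le_ceil _).trans (Nat.cast_le.mpr (hju.trans ?_))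
  rw [← Set.ncard_coe_finset]
  exact Set.ncard_le_ncard (fun x hx => (Finset.mem_filter.mp hx).2) (Set.toFinite _)
end

section
/- Let (V, <) be a finite strict partially ordered set with n elements, and let k be a positive integer with n > 10k. Suppose that among every k elements of V, some two are comparable (equivalently, every antichain of V has fewer than k elements). Then more than n/2 elements u of V satisfy: the number of elements x with x < u is at least n/(3k). -/
/-- In a finite strict order, the number of elements below is strictly monotone. -/
theorem ncard_setOf_lt_of_rel {V : Type*} [Finite V] {r : V → V → Prop}
    (hirr : ∀ x, ¬ r x x) (htrans : ∀ x y z, r x y → r y z → r x z) {u v : V} (h : r u v) :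
    {x | r x u}.ncard < {x | r x v}.ncard :=
  Set.ncard_lt_ncard ⟨fun x hx => htrans x u v hx h, fun hsub => hirr u (hsub h)⟩

/-- In a finite strict order all of whose antichains have at most `w` elements, at most `w * m`
elements have fewer than `m` elements below them. -/
theorem ncard_setOf_ncard_lt_le {V : Type*} [Fintype V] {r : V → V → Prop}
    (hirr : ∀ x, ¬ r x x) (htrans : ∀ x y z, r x y → r y z → r x z) {w : ℕ}
    (hw : ∀ s : Finset V, (∀ u ∈ s, ∀ v ∈ s, ¬ r u v) → s.card ≤ w) (m : ℕ) :
    {u | {x | r x u}.ncard < m}.ncard ≤ w * m := by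
  classical
  rw [Set.ncard_eq_toFinset_card']
  have h := Finset.card_le_mul_card_image_of_maps_to
    (s := {u | {x | r x u}.ncard < m}.toFinset) (t := Finset.range m)
    (f := fun u => {x | r x u}.ncard) (fun u hu => by simpa using hu) w
    (fun b _ => hw _ fun u hu v hv huv => by
      have hlt := ncard_setOf_lt_of_rel hirr htrans huv
      have hu' := (Finset.mem_filter.1 hu).2
      have hv' := (Finset.mem_filter.1 hv).2
      omega)
  simpa using h


/-- Lemma 4.2 (downward direction): in a finite strict poset with `n > 10k`
elements in which among any `k` elements some two are comparable, more than
`n/2` elements have at least `n/(3k)` elements below them. -/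
theorem stmt_3 {V : Type*} [Fintype V]
    (n : ℕ) (hn : n = Fintype.card V)
    (r : V → V → Prop)
    (hirr : ∀ x, ¬ r x x)
    (htrans : ∀ x y z, r x y → r y z → r x z)
    (k : ℕ) (hk : 0 < k) (hnk : n > 10 * k)
    (hcomp : ∀ s : Finset V, s.card = k →
      ∃ u ∈ s, ∃ v ∈ s, u ≠ v ∧ (r u v ∨ r v u)) :
    (n : ℝ) / 2 <
      ({u : V | (n : ℝ) / (3 * k) ≤ ({x : V | r x u} : Set V).ncard} : Set V).ncard := by
  have hw : ∀ s : Finset V, (∀ u ∈ s, ∀ v ∈ s, ¬ r u v) → s.card ≤ k := by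
    intro s hs
    by_contra! hlt
    obtain ⟨t, hts, ht⟩ := Finset.exists_subset_card_eq hlt.le
    obtain ⟨u, hu, v, hv, -, huv | hvu⟩ := hcomp t ht
    · exact hs u (hts hu) v (hts hv) huv
    · exact hs v (hts hv) u (hts hu) hvu
  have hbad := ncard_setOf_ncard_lt_le hirr htrans hw ⌈(n : ℝ) / (3 * k)⌉₊
  simp only [Nat.lt_ceil] at hbad
  have hadd := Set.ncard_add_ncard_compl {u : V | (n : ℝ) / (3 * k) ≤ {x : V | r x u}.ncard}
  simp only [Set.compl_ofPred, not_le, Nat.card_eq_fintype_card, ← hn] at hadd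
  have hkpos : (0 : ℝ) < k := by exact_mod_cast hk
  have hnk' : (10 : ℝ) * k < n := by exact_mod_cast hnk
  have hceil : (⌈(n : ℝ) / (3 * k)⌉₊ : ℝ) < n / (3 * k) + 1 := Nat.ceil_lt_add_one (by positivity)
  have hmul : (k : ℝ) * ⌈(n : ℝ) / (3 * k)⌉₊ < n / 3 + k := by
    calc (k : ℝ) * ⌈(n : ℝ) / (3 * k)⌉₊ < k * (n / (3 * k) + 1) := by gcongr
      _ = n / 3 + k := by field_simp
  rify at hbad hadd
  linarith
end

section
/- Let (V, <) be a finite strict partially ordered set and let k be a positive integer such that every antichain of V has fewer than k elements. Then for every natural number t, the number of elements u ∈ V for which fewer than t elements x satisfy x < u is at most t·(k−1). -/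
open Classical in
/-- Relative form of the layered counting bound: inside a finite set `S`, at most `t * n` elements
have fewer than `t` elements of `S` below them, if every antichain has at most `n` elements. -/
theorem card_filter_card_lt_le_mul {V : Type*} [Finite V] (r : V → V → Prop)
    (hirr : ∀ x, ¬ r x x) (htrans : ∀ x y z, r x y → r y z → r x z) (n : ℕ)
    (hanti : ∀ s : Finset V,
      (∀ u ∈ s, ∀ v ∈ s, u ≠ v → ¬ r u v ∧ ¬ r v u) → s.card ≤ n)
    (t : ℕ) (S : Finset V) :
    (S.filter fun u => (S.filter fun x => r x u).card < t).card ≤ t * n := by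
  induction t generalizing S with
  | zero => simp
  | succ t ih =>
    have : IsTrans V r := ⟨htrans⟩
    have : Std.Irrefl r := ⟨hirr⟩
    have hwf : WellFounded r := Finite.wellFounded_of_trans_of_irrefl r
    set M := S.filter fun u => ∀ x ∈ S, ¬ r x u with hM
    have hMcard : M.card ≤ n := by
      refine hanti M fun u hu v hv _ => ?_
      rw [hM, Finset.mem_filter] at hu hv
      exact ⟨hv.2 u hu.1, hu.2 v hv.1⟩
    have hsub : (S.filter fun u => (S.filter fun x => r x u).card < t + 1) ⊆
        M ∪ ((S \ M).filter fun u => ((S \ M).filter fun x => r x u).card < t) := by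
      intro u hu
      rw [Finset.mem_filter] at hu
      rw [Finset.mem_union]
      by_cases huM : u ∈ M
      · exact Or.inl huM
      · refine Or.inr (Finset.mem_filter.2 ⟨Finset.mem_sdiff.2 ⟨hu.1, huM⟩, ?_⟩)
        have hne : {x | x ∈ S ∧ r x u}.Nonempty := by
          by_contra h
          refine huM (Finset.mem_filter.2 ⟨hu.1, fun x hx hxu => h ⟨x, hx, hxu⟩⟩)
        obtain ⟨m, ⟨hmS, hmu⟩, hmin⟩ := hwf.has_min _ hne
        have hmM : m ∈ M := Finset.mem_filter.2
          ⟨hmS, fun x hx hxm => hmin x ⟨hx, htrans x m u hxm hmu⟩ hxm⟩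
        have hlt : ((S \ M).filter fun x => r x u).card < (S.filter fun x => r x u).card := by
          refine Finset.card_lt_card (Finset.ssubset_iff_of_subset
            (Finset.filter_subset_filter _ Finset.sdiff_subset) |>.2
              ⟨m, Finset.mem_filter.2 ⟨hmS, hmu⟩, fun h => ?_⟩)
          exact (Finset.mem_sdiff.1 (Finset.mem_filter.1 h).1).2 hmM
        omega
    calc _ ≤ _ := Finset.card_le_card hsub
      _ ≤ _ := Finset.card_union_le _ _
      _ ≤ n + t * n := Nat.add_le_add hMcard (ih _)
      _ = (t + 1) * n := by ring

/-- Layered counting bound (downward direction): in a finite strict poset all of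
whose antichains have fewer than `k` elements, for every `t` at most `t·(k−1)`
elements have fewer than `t` elements below them. -/
theorem stmt_5 {V : Type*} [Fintype V]
    (r : V → V → Prop)
    (hirr : ∀ x, ¬ r x x)
    (htrans : ∀ x y z, r x y → r y z → r x z)
    (k : ℕ) (hk : 0 < k)
    (hanti : ∀ s : Finset V,
      (∀ u ∈ s, ∀ v ∈ s, u ≠ v → ¬ r u v ∧ ¬ r v u) → s.card < k)
    (t : ℕ) :
    ({u : V | ({x : V | r x u} : Set V).ncard < t} : Set V).ncard ≤ t * (k - 1) := by
  classical
  have h := card_filter_card_lt_le_mul r hirr htrans (k - 1)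
    (fun s hs => Nat.le_sub_one_of_lt (hanti s hs)) t Finset.univ
  simpa [← Set.ncard_coe_finset] using h
end

section
/- Let V be a finite set equipped with a strict linear order <, let G be a simple graph on V, let k be a positive integer, and let f : V → Fin k be a coloring such that any two distinct vertices with the same color are adjacent in G. Let A be a binary relation on V satisfying: (i) for all u, v ∈ V with u < v and f(u) = f(v), if no vertex w with f(w) = f(u) satisfies u < w < v, then A(u, v) holds; and (ii) for every vertex u and every color i, if there exists a vertex w with f(w) = i, w adjacent to u in G, and u < w, then there exists a vertex T with f(T) = i, u < T, A(u, T), and T ≤ w for every vertex w with f(w) = i that is adjacent to u in G and satisfies u < w. Then for every edge {u, v} of G with u < v, the pair (u, v) lies in the reflexive-transitive closure of A. -/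
/-- Abstract form of Lemma 3.1 (correctness of ColorSolve): under conditions
(i) and (ii) on the probed edge relation `A`, every correctly oriented edge of
`G` is recovered in the reflexive-transitive closure of `A`. -/
theorem stmt_11 {V : Type*} [Fintype V] [LinearOrder V]
    (G : SimpleGraph V) (k : ℕ) (f : V → Fin k)
    (hcolor : ∀ u v : V, u ≠ v → f u = f v → G.Adj u v)
    (A : V → V → Prop)
    (hchain : ∀ u v : V, u < v → f u = f v →
      (∀ w : V, f w = f u → ¬ (u < w ∧ w < v)) → A u v)
    (hadd : ∀ u : V, ∀ i : Fin k,
      (∃ w : V, f w = i ∧ G.Adj u w ∧ u < w) →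
      ∃ T : V, f T = i ∧ u < T ∧ A u T ∧
        ∀ w : V, f w = i → G.Adj u w → u < w → T ≤ w) :
    ∀ u v : V, G.Adj u v → u < v → Relation.ReflTransGen A u v := by
  intro u
  induction u using WellFoundedGT.induction with
  | ind u ih =>
    intro v huv hlt
    obtain ⟨T, hTv, huT, hA, hmin⟩ := hadd u (f v) ⟨v, rfl, huv, hlt⟩
    rcases (hmin v rfl huv hlt).eq_or_lt with rfl | hT
    · exact .single hA
    · exact .head hA (ih T huT v (hcolor T v hT.ne hTv) hT)
end
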